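/- If τ ∈ 𝓛 and δ ∈ (0, m_τ), then there exists a sequence of points {z_j} ⊂ 𝔻 such that: (1) z_j ∉ D(δτ(z_k)) for all j ≠ k; (2) ⋃_j D(δτ(z_j)) = 𝔻; (3) for each j, ⋃_{z ∈ D(δτ(z_j))} D(δτ(z)) ⊆ D(3δτ(z_j)); and (4) the family {D(3δτ(z_j))} is a covering of 𝔻 of finite multiplicity N, with N independent of δ. -/

import Mathlib

open MeasureTheory Filter Set
open scoped ENNReal ComplexOrder

noncomputable section

/-- The open unit disc in `ℂ`. -/
def unitDisc : Set ℂ := Metric.ball (0 : ℂ) 1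

/-- Normalized area Lebesgue measure `dA = dx dy / π` on `ℂ`. -/
def dA : Measure ℂ := (ENNReal.ofReal Real.pi)⁻¹ • (volume : Measure ℂ)

/-- The weighted measure `ω dA` on the unit disc. -/
def muW (ω : ℂ → ℝ) : Measure ℂ :=
  (dA.restrict unitDisc).withDensity fun z => ENNReal.ofReal (ω z)

/-- The radial extension to `𝔻` of a function of `r ∈ [0,1)`. -/
def radialize (τ : ℝ → ℝ) : ℂ → ℝ := fun z => τ ‖z‖

/-- The class `𝓛`, with constants `c₁, c₂`. -/
structure IsClassL (τC : ℂ → ℝ) (c₁ c₂ : ℝ) : Prop where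
  c₁_pos : 0 < c₁
  c₂_pos : 0 < c₂
  pos : ∀ z ∈ unitDisc, 0 < τC z
  upper : ∀ z ∈ unitDisc, τC z ≤ c₁ * (1 - ‖z‖)
  lip : ∀ z ∈ unitDisc, ∀ ζ ∈ unitDisc, |τC z - τC ζ| ≤ c₂ * ‖z - ζ‖

/-- `m_τ = min(1, c₁⁻¹, c₂⁻¹)/4`. -/
def mTau (c₁ c₂ : ℝ) : ℝ := min 1 (min c₁⁻¹ c₂⁻¹) / 4

/-- The Laplacian `Δφ = φ_xx + φ_yy` of a function `φ : ℂ → ℝ`. -/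
def laplacian (φ : ℂ → ℝ) (z : ℂ) : ℝ :=
  fderiv ℝ (fun w => fderiv ℝ φ w 1) z 1 +
    fderiv ℝ (fun w => fderiv ℝ φ w Complex.I) z Complex.I

/-- The Wirtinger derivative `∂̄g = (g_x + i g_y)/2` of `g : ℂ → ℂ`. -/
def dbar (g : ℂ → ℂ) (z : ℂ) : ℂ :=
  (fderiv ℝ g z 1 + Complex.I * fderiv ℝ g z Complex.I) / 2

/-- The class `𝒲` of weights `ω = e^{-2φ}` with associated radial profile `τ`. -/
structure IsClassW (ω φ : ℂ → ℝ) (τ : ℝ → ℝ) : Prop where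
  pos : ∀ z ∈ unitDisc, 0 < ω z
  omega_eq : ∀ z ∈ unitDisc, ω z = Real.exp (-(2 * φ z))
  integrable : ∫⁻ z in unitDisc, ENNReal.ofReal (ω z) ∂dA < ⊤
  radial : ∀ z ∈ unitDisc, ∀ ζ ∈ unitDisc, ‖z‖ = ‖ζ‖ → φ z = φ ζ
  smooth : ContDiffOn ℝ 2 φ unitDisc
  lap_pos : ∀ z ∈ unitDisc, 0 < laplacian φ z
  tau_pos : ∀ r ∈ Set.Ico (0 : ℝ) 1, 0 < τ r
  tau_anti : AntitoneOn τ (Set.Ico 0 1)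
  tau_lim : Tendsto τ (nhdsWithin 1 (Set.Iio 1)) (nhds 0)
  tau_diff : ∀ r ∈ Set.Ico (0 : ℝ) 1, DifferentiableAt ℝ τ r
  tau_deriv_lim : Tendsto (deriv τ) (nhdsWithin 1 (Set.Iio 1)) (nhds 0)
  comp : ∃ C : ℝ, 1 ≤ C ∧ ∀ z ∈ unitDisc,
    τ ‖z‖ / C ≤ (laplacian φ z) ^ (-(1 / 2 : ℝ)) ∧
      (laplacian φ z) ^ (-(1 / 2 : ℝ)) ≤ C * τ ‖z‖
  extra : (∃ C > (0 : ℝ), ∃ r₀ ∈ Set.Ico (0 : ℝ) 1,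
      MonotoneOn (fun r => τ r * (1 - r) ^ C) (Set.Ico r₀ 1)) ∨
    Tendsto (fun r => deriv τ r * Real.log (1 / τ r)) (nhdsWithin 1 (Set.Iio 1)) (nhds 0)

/-- A `(δ,τ)`-lattice of the unit disc. -/
structure IsLattice (τC : ℂ → ℝ) (δ : ℝ) (z : ℕ → ℂ) : Prop where
  mem : ∀ j, z j ∈ unitDisc
  sep : ∀ j k, j ≠ k → z j ∉ Metric.ball (z k) (δ * τC (z k))
  covers : ∀ w ∈ unitDisc, ∃ j, w ∈ Metric.ball (z j) (δ * τC (z j))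
  mult : ∃ N : ℕ, ∀ w ∈ unitDisc,
    ({j : ℕ | w ∈ Metric.ball (z j) (3 * (δ * τC (z j)))}).ncard ≤ N

/-- The distance `d_τ(z,ζ) = |z-ζ| / min(τ(z),τ(ζ))`. -/
def dTau (τC : ℂ → ℝ) (z ζ : ℂ) : ℝ := ‖z - ζ‖ / min (τC z) (τC ζ)

/-- `(1/|D(δτ(z))|) ∫_{D(δτ(z))} |u|² dA`, valued in `ℝ≥0∞`. -/
def localMeanE (τC : ℂ → ℝ) (δ : ℝ) (u : ℂ → ℂ) (z : ℂ) : ℝ≥0∞ :=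
  (ENNReal.ofReal ((δ * τC z) ^ 2))⁻¹ *
    ∫⁻ w in Metric.ball z (δ * τC z), ENNReal.ofReal (‖u w‖ ^ 2) ∂dA

/-- `F_δ(z)² = inf over h analytic in D(δτ(z)) of the mean square of g - h`. -/
def FdeltaSqE (τC : ℂ → ℝ) (δ : ℝ) (g : ℂ → ℂ) (z : ℂ) : ℝ≥0∞ :=
  ⨅ (h : ℂ → ℂ) (_ : DifferentiableOn ℂ h (Metric.ball z (δ * τC z))),
    localMeanE τC δ (fun w => g w - h w) z

/-- The submodule of `L²_ω` of elements with a representative analytic on `𝔻`. -/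
def bergmanSubmodule (ω : ℂ → ℝ) : Submodule ℂ (Lp ℂ 2 (muW ω)) where
  carrier := {f | ∃ F : ℂ → ℂ, DifferentiableOn ℂ F unitDisc ∧ (f : ℂ → ℂ) =ᵐ[muW ω] F}
  zero_mem' := ⟨0, differentiableOn_const 0, Lp.coeFn_zero ℂ 2 (muW ω)⟩
  add_mem' := by
    rintro a b ⟨F, hF, ha⟩ ⟨G, hG, hb⟩
    refine ⟨F + G, hF.add hG, ?_⟩
    filter_upwards [Lp.coeFn_add a b, ha, hb] with w h1 h2 h3
    rw [h1]; simp only [Pi.add_apply, h2, h3]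
  smul_mem' := by
    rintro c a ⟨F, hF, ha⟩
    refine ⟨c • F, hF.const_smul c, ?_⟩
    filter_upwards [Lp.coeFn_smul c a, ha] with w h1 h2
    rw [h1]; simp only [Pi.smul_apply, h2]

/-- The Bergman space `A²_ω`, a closed subspace of `L²_ω`. -/
def bergmanH (ω : ℂ → ℝ) : Submodule ℂ (Lp ℂ 2 (muW ω)) :=
  (bergmanSubmodule ω).topologicalClosure

instance (ω : ℂ → ℝ) : CompleteSpace (bergmanH ω) :=
  IsComplete.completeSpace_coe (IsClosed.isComplete (Submodule.isClosed_topologicalClosure _))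

/-- The orthogonal (Bergman) projection of `L²_ω` onto `A²_ω`, valued in `A²_ω`. -/
def bergmanProjA (ω : ℂ → ℝ) : Lp ℂ 2 (muW ω) →L[ℂ] bergmanH ω :=
  Submodule.orthogonalProjectionOnto (bergmanH ω)

/-- The Bergman projection `P`, viewed as an operator of `L²_ω`. -/
def bergmanProj (ω : ℂ → ℝ) : Lp ℂ 2 (muW ω) →L[ℂ] Lp ℂ 2 (muW ω) :=
  (bergmanH ω).subtypeL.comp (bergmanProjA ω)

/-- `T` is a bounded extension of the Hankel operator `H_g : f ↦ g f - P(g f)`,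
defined on the bounded analytic functions `f ∈ H^∞`. -/
def IsHankelExtension (ω : ℂ → ℝ) (g : ℂ → ℂ)
    (T : bergmanH ω →L[ℂ] Lp ℂ 2 (muW ω)) : Prop :=
  ∀ (f : bergmanH ω) (F : ℂ → ℂ) (M : ℝ),
    DifferentiableOn ℂ F unitDisc →
    (∀ z ∈ unitDisc, ‖F z‖ ≤ M) →
    ((f : Lp ℂ 2 (muW ω)) : ℂ → ℂ) =ᵐ[muW ω] F →
    ∀ gF : Lp ℂ 2 (muW ω), ((gF : ℂ → ℂ) =ᵐ[muW ω] fun z => g z * F z) →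
    T f = gF - bergmanProj ω gF

/-- The `ν`-th singular number `s_ν(T) = inf{‖T - K‖ : rank K ≤ ν}`, `ν = 0, 1, 2, …`. -/
def singularNumber {E F : Type*} [NormedAddCommGroup E] [NormedSpace ℂ E]
    [NormedAddCommGroup F] [NormedSpace ℂ F] (T : E →L[ℂ] F) (ν : ℕ) : ℝ :=
  sInf {c : ℝ | ∃ K : E →L[ℂ] F,
    Module.rank ℂ (LinearMap.range (K : E →ₗ[ℂ] F)) ≤ (ν : Cardinal) ∧ c = ‖T - K‖}

/-- `‖T‖_{S^p}^p = ∑_ν s_ν(T)^p`. -/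
def schattenSum (p : ℝ) {E F : Type*} [NormedAddCommGroup E] [NormedSpace ℂ E]
    [NormedAddCommGroup F] [NormedSpace ℂ F] (T : E →L[ℂ] F) : ℝ :=
  ∑' ν : ℕ, singularNumber T ν ^ p

/-- Membership in the Schatten class `S^p`: `∑_ν s_ν(T)^p < ∞`. -/
def MemSchatten (p : ℝ) {E F : Type*} [NormedAddCommGroup E] [NormedSpace ℂ E]
    [NormedAddCommGroup F] [NormedSpace ℂ F] (T : E →L[ℂ] F) : Prop :=
  Summable fun ν : ℕ => singularNumber T ν ^ p

/-- A bounded operator has finite rank. -/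
def FiniteRank {E F : Type*} [NormedAddCommGroup E] [NormedSpace ℂ E]
    [NormedAddCommGroup F] [NormedSpace ℂ F] (T : E →L[ℂ] F) : Prop :=
  Module.rank ℂ (LinearMap.range (T : E →ₗ[ℂ] F)) < Cardinal.aleph0

/-- The decay estimate `|F(z)| ω(z)^{1/2} ≲ min(1, min(τ(α),τ(z))/|z-α|)^{3n}` on `𝔻`. -/
def TestDecay (τC ω : ℂ → ℝ) (C₀ : ℝ) (n : ℕ) (α : ℂ) (F : ℂ → ℂ) : Prop :=
  (∀ z ∈ unitDisc, ‖F z‖ * Real.sqrt (ω z) ≤ C₀) ∧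
    ∀ z ∈ unitDisc, z ≠ α → ‖F z‖ * Real.sqrt (ω z) ≤
      C₀ * (min (τC α) (τC z) / ‖z - α‖) ^ (3 * n)

/-- Multiplication of an `L²_ω` element by the indicator of a measurable set `D`. -/
def indLp (ω : ℂ → ℝ) (D : Set ℂ) (hD : MeasurableSet D) (f : Lp ℂ 2 (muW ω)) :
    Lp ℂ 2 (muW ω) :=
  MemLp.toLp (D.indicator f) ((Lp.memLp f).indicator hD)

/-- The subspace of `L²_ω` of elements vanishing a.e. off `D` with a representative
analytic on `D`;  its closure realizes `A²_ω(D)` inside `L²_ω`. -/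
def localBergmanSub (ω : ℂ → ℝ) (D : Set ℂ) : Submodule ℂ (Lp ℂ 2 (muW ω)) where
  carrier := {f | ((f : ℂ → ℂ) =ᵐ[(muW ω).restrict Dᶜ] 0) ∧
    ∃ h : ℂ → ℂ, DifferentiableOn ℂ h D ∧ (f : ℂ → ℂ) =ᵐ[(muW ω).restrict D] h}
  zero_mem' := by
    refine ⟨ae_restrict_of_ae (Lp.coeFn_zero ℂ 2 (muW ω)), 0, differentiableOn_const 0,
      ae_restrict_of_ae (Lp.coeFn_zero ℂ 2 (muW ω))⟩
  add_mem' := by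
    rintro a b ⟨ha0, F, hF, ha⟩ ⟨hb0, G, hG, hb⟩
    refine ⟨?_, F + G, hF.add hG, ?_⟩
    · filter_upwards [ae_restrict_of_ae (Lp.coeFn_add a b), ha0, hb0] with w h1 h2 h3
      rw [h1]; simp only [Pi.add_apply, h2, h3, Pi.zero_apply, add_zero]
    · filter_upwards [ae_restrict_of_ae (Lp.coeFn_add a b), ha, hb] with w h1 h2 h3
      rw [h1]; simp only [Pi.add_apply, h2, h3]
  smul_mem' := by
    rintro c a ⟨ha0, F, hF, ha⟩
    refine ⟨?_, c • F, hF.const_smul c, ?_⟩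
    · filter_upwards [ae_restrict_of_ae (Lp.coeFn_smul c a), ha0] with w h1 h2
      rw [h1]; simp only [Pi.smul_apply, h2, Pi.zero_apply, smul_zero]
    · filter_upwards [ae_restrict_of_ae (Lp.coeFn_smul c a), ha] with w h1 h2
      rw [h1]; simp only [Pi.smul_apply, h2]

instance (ω : ℂ → ℝ) (D : Set ℂ) :
    CompleteSpace ((localBergmanSub ω D).topologicalClosure) :=
  IsComplete.completeSpace_coe (IsClosed.isComplete (Submodule.isClosed_topologicalClosure _))

/-- The local projection `P_{α,δ}` (for `D = D(δτ(α))`), extended by zero off `D`,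
viewed as an operator of `L²_ω`. -/
def localProj (ω : ℂ → ℝ) (D : Set ℂ) : Lp ℂ 2 (muW ω) →L[ℂ] Lp ℂ 2 (muW ω) :=
  ((localBergmanSub ω D).topologicalClosure).subtypeL.comp
    (Submodule.orthogonalProjectionOnto ((localBergmanSub ω D).topologicalClosure))

/-- Pigeonhole: half-separated points in a bounded region are finitely many, with a bound. -/
lemma stmt9_pigeon (M : ℕ) (S : Set ℕ) (u : ℕ → ℂ) (hu : ∀ j ∈ S, ‖u j‖ ≤ M)
    (hsep : ∀ j ∈ S, ∀ k ∈ S, j ≠ k → 1 / 2 ≤ ‖u j - u k‖) :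
    S.Finite ∧ S.ncard ≤ (8 * M + 1) ^ 2 := by
  let f : ℕ → ℤ × ℤ := fun j => (⌊4 * (u j).re⌋, ⌊4 * (u j).im⌋)
  let T : Finset (ℤ × ℤ) := Finset.Icc (-(4 * M : ℤ)) (4 * M) ×ˢ Finset.Icc (-(4 * M : ℤ)) (4 * M)
  have hcell : ∀ x : ℝ, |x| ≤ M → ⌊4 * x⌋ ∈ Finset.Icc (-(4 * M : ℤ)) (4 * M) := by
    intro x hx
    rw [abs_le] at hx
    rw [Finset.mem_Icc]
    constructor
    · rw [Int.le_floor]; push_cast; linarith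
    · have h1 : (⌊4 * x⌋ : ℝ) ≤ 4 * x := Int.floor_le _
      have h2 : (⌊4 * x⌋ : ℝ) ≤ ((4 * M : ℤ) : ℝ) := by push_cast; linarith
      exact_mod_cast h2
  have hmaps : ∀ j ∈ S, f j ∈ (T : Set (ℤ × ℤ)) := by
    intro j hj
    simp only [T, f, Finset.coe_product, Set.mem_prod, Finset.mem_coe]
    exact ⟨hcell _ ((Complex.abs_re_le_norm _).trans (hu j hj)),
      hcell _ ((Complex.abs_im_le_norm _).trans (hu j hj))⟩
  have hinj : Set.InjOn f S := by
    intro j hj k hk hjk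
    by_contra hne
    have h := hsep j hj k hk hne
    simp only [f, Prod.mk.injEq] at hjk
    have h1 := Int.abs_sub_lt_one_of_floor_eq_floor hjk.1
    have h2 := Int.abs_sub_lt_one_of_floor_eq_floor hjk.2
    have h3 := Complex.norm_le_abs_re_add_abs_im (u j - u k)
    rw [Complex.sub_re, Complex.sub_im] at h3
    rw [← mul_sub, abs_mul, abs_of_pos (by norm_num : (0 : ℝ) < 4)] at h1 h2
    linarith
  refine ⟨Set.Finite.of_injOn hmaps hinj T.finite_toSet, ?_⟩
  have hc := Set.ncard_le_ncard_of_injOn f hmaps hinj T.finite_toSet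
  refine hc.trans (le_of_eq ?_)
  rw [Set.ncard_coe_finset, Finset.card_product, Int.card_Icc, sq]
  have : ((4 * M : ℤ) + 1 - -(4 * M : ℤ)).toNat = 8 * M + 1 := by omega
  rw [this]

/-- One greedy step: among the uncovered points there is one maximizing `τ`. -/
lemma stmt9_step (τC : ℂ → ℝ) (c₁ c₂ : ℝ) (hL : IsClassL τC c₁ c₂) (δ : ℝ) (hδ : 0 < δ)
    (hδ1 : δ * c₁ ≤ 1 / 4) (s : Finset ℂ) (hs : ∀ x ∈ s, x ∈ unitDisc) :
    ∃ y ∈ unitDisc, (∀ x ∈ s, y ∉ Metric.ball x (δ * τC x)) ∧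
      ∀ u ∈ unitDisc, (∀ x ∈ s, u ∉ Metric.ball x (δ * τC x)) → τC u ≤ τC y := by
  have hD : ∀ x : ℂ, x ∈ unitDisc ↔ ‖x‖ < 1 := fun x => by simp [unitDisc]
  -- an uncovered point
  obtain ⟨w, hw, hws⟩ : ∃ w ∈ unitDisc, ∀ x ∈ s, w ∉ Metric.ball x (δ * τC x) := by
    obtain ⟨m, hm, hmax⟩ := Finset.exists_max_image (insert (0 : ℂ) s) (fun x => ‖x‖)
      (Finset.insert_nonempty _ _)
    have hm1 : ‖m‖ < 1 := by
      rcases Finset.mem_insert.1 hm with h | h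
      · simp [h]
      · exact (hD m).1 (hs m h)
    have hn : ‖((1 / 4 + 3 / 4 * ‖m‖ : ℝ) : ℂ)‖ = 1 / 4 + 3 / 4 * ‖m‖ := by
      rw [Complex.norm_real, Real.norm_of_nonneg (by positivity)]
    refine ⟨((1 / 4 + 3 / 4 * ‖m‖ : ℝ) : ℂ), (hD _).2 (by rw [hn]; linarith), ?_⟩
    intro x hx hmem
    rw [Metric.mem_ball, dist_eq_norm] at hmem
    have h1 := norm_sub_norm_le ((1 / 4 + 3 / 4 * ‖m‖ : ℝ) : ℂ) x
    rw [hn] at h1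
    have h2 : ‖x‖ ≤ ‖m‖ := hmax x (Finset.mem_insert_of_mem hx)
    have h3 := mul_le_mul_of_nonneg_left (hL.upper x (hs x hx)) hδ.le
    have h4 : δ * c₁ * (1 - ‖x‖) ≤ 1 / 4 * (1 - ‖x‖) :=
      mul_le_mul_of_nonneg_right hδ1 (by linarith)
    linarith
  have hτw := hL.pos w hw
  let K : Set ℂ := Metric.closedBall 0 (1 - τC w / c₁) \ ⋃ x ∈ s, Metric.ball x (δ * τC x)
  have hKc : IsCompact K := (isCompact_closedBall _ _).diff
    (isOpen_biUnion fun x _ => Metric.isOpen_ball)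
  have hKD : ∀ x ∈ K, x ∈ unitDisc := by
    intro x hx
    have h1 : ‖x‖ ≤ 1 - τC w / c₁ := by simpa using hx.1
    have := div_pos hτw hL.c₁_pos
    exact (hD x).2 (by linarith)
  have hK : ∀ u ∈ unitDisc, (∀ x ∈ s, u ∉ Metric.ball x (δ * τC x)) → τC w ≤ τC u → u ∈ K := by
    intro u hu hus hwu
    refine ⟨?_, ?_⟩
    · rw [mem_closedBall_zero_iff]
      have h1 : τC w / c₁ ≤ 1 - ‖u‖ := by
        rw [div_le_iff₀ hL.c₁_pos]
        linarith [hL.upper u hu]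
      linarith
    · intro h
      simp only [Set.mem_iUnion] at h
      obtain ⟨x, hx, h⟩ := h
      exact hus x hx h
  have hcont : ContinuousOn τC K := by
    refine LipschitzOnWith.continuousOn (K := c₂.toNNReal) ?_
    refine LipschitzOnWith.of_dist_le_mul ?_
    intro x hx y hy
    rw [Real.dist_eq, dist_eq_norm, Real.coe_toNNReal _ hL.c₂_pos.le]
    exact hL.lip x (hKD x hx) y (hKD y hy)
  obtain ⟨y, hy, hmax⟩ := hKc.exists_isMaxOn ⟨w, hK w hw hws le_rfl⟩ hcont
  refine ⟨y, hKD y hy, ?_, ?_⟩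
  · intro x hx h
    exact hy.2 (Set.mem_biUnion hx h)
  · intro u hu hus
    rcases le_total (τC w) (τC u) with h | h
    · exact hmax (hK u hu hus h)
    · exact h.trans (hmax (hK w hw hws le_rfl))

/-- The greedy sequence. -/
lemma stmt9_seq (τC : ℂ → ℝ) (c₁ c₂ : ℝ) (hL : IsClassL τC c₁ c₂) (δ : ℝ) (hδ : 0 < δ)
    (hδ1 : δ * c₁ ≤ 1 / 4) :
    ∃ z : ℕ → ℂ, (∀ j, z j ∈ unitDisc) ∧
      (∀ j k, j < k → z k ∉ Metric.ball (z j) (δ * τC (z j))) ∧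
      (∀ k, ∀ u ∈ unitDisc, (∀ j < k, u ∉ Metric.ball (z j) (δ * τC (z j))) →
        τC u ≤ τC (z k)) := by
  have step := stmt9_step τC c₁ c₂ hL δ hδ hδ1
  choose! F hF1 hF2 hF3 using step
  let s : ℕ → Finset ℂ := fun n => Nat.rec ∅ (fun _ t => insert (F t) t) n
  have hs0 : s 0 = ∅ := rfl
  have hs1 : ∀ n, s (n + 1) = insert (F (s n)) (s n) := fun n => rfl
  have hmem : ∀ n x, x ∈ s n ↔ ∃ m < n, x = F (s m) := by
    intro n
    induction n with
    | zero => intro x; simp [hs0]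
    | succ n ih =>
      intro x
      rw [hs1, Finset.mem_insert, ih]
      constructor
      · rintro (h | ⟨m, hm, h⟩)
        · exact ⟨n, by omega, h⟩
        · exact ⟨m, by omega, h⟩
      · rintro ⟨m, hm, h⟩
        rcases Nat.lt_succ_iff_lt_or_eq.1 hm with h' | h'
        · exact Or.inr ⟨m, h', h⟩
        · subst h'; exact Or.inl h
  have hD : ∀ n, ∀ x ∈ s n, x ∈ unitDisc := by
    intro n
    induction n with
    | zero => intro x hx; simp [hs0] at hx
    | succ n ih =>
      intro x hx
      rw [hs1, Finset.mem_insert] at hx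
      rcases hx with rfl | hx
      · exact hF1 _ ih
      · exact ih x hx
  refine ⟨fun n => F (s n), fun j => hF1 _ (hD j), ?_, ?_⟩
  · intro j k hjk
    exact hF2 _ (hD k) _ ((hmem k _).2 ⟨j, hjk, rfl⟩)
  · intro k u hu h
    refine hF3 _ (hD k) u hu ?_
    intro x hx
    obtain ⟨m, hm, rfl⟩ := (hmem k x).1 hx
    exact h m hm

theorem stmt9 (τC : ℂ → ℝ) (c₁ c₂ : ℝ) (hL : IsClassL τC c₁ c₂) :
    ∃ N : ℕ, ∀ δ ∈ Set.Ioo 0 (mTau c₁ c₂), ∃ z : ℕ → ℂ,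
      (∀ j, z j ∈ unitDisc) ∧
      (∀ j k, j ≠ k → z j ∉ Metric.ball (z k) (δ * τC (z k))) ∧
      (∀ w ∈ unitDisc, ∃ j, w ∈ Metric.ball (z j) (δ * τC (z j))) ∧
      (∀ j, ∀ w ∈ Metric.ball (z j) (δ * τC (z j)),
        Metric.ball w (δ * τC w) ⊆ Metric.ball (z j) (3 * (δ * τC (z j)))) ∧
      (∀ w ∈ unitDisc,
        ({j : ℕ | w ∈ Metric.ball (z j) (3 * (δ * τC (z j)))}).ncard ≤ N) := by
  refine ⟨(8 * 12 + 1) ^ 2, ?_⟩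
  rintro δ ⟨hδ, hδm⟩
  have hc1 := hL.c₁_pos
  have hc2 := hL.c₂_pos
  have hδ1 : δ * c₁ ≤ 1 / 4 := by
    have h : δ ≤ c₁⁻¹ / 4 := hδm.le.trans (by
      unfold mTau
      have := (min_le_right (1 : ℝ) (min c₁⁻¹ c₂⁻¹)).trans (min_le_left _ _)
      linarith)
    calc δ * c₁ ≤ c₁⁻¹ / 4 * c₁ := mul_le_mul_of_nonneg_right h hc1.le
      _ = 1 / 4 := by field_simp
  have hδ2 : δ * c₂ ≤ 1 / 4 := by
    have h : δ ≤ c₂⁻¹ / 4 := hδm.le.trans (by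
      unfold mTau
      have := (min_le_right (1 : ℝ) (min c₁⁻¹ c₂⁻¹)).trans (min_le_right _ _)
      linarith)
    calc δ * c₂ ≤ c₂⁻¹ / 4 * c₂ := mul_le_mul_of_nonneg_right h hc2.le
      _ = 1 / 4 := by field_simp
  have hD : ∀ x : ℂ, x ∈ unitDisc ↔ ‖x‖ < 1 := fun x => by simp [unitDisc]
  obtain ⟨z, hz, hzs, hzm⟩ := stmt9_seq τC c₁ c₂ hL δ hδ hδ1
  have hpos : ∀ j, 0 < τC (z j) := fun j => hL.pos _ (hz j)
  have hmono : ∀ j k, j < k → τC (z k) ≤ τC (z j) := fun j k hjk =>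
    hzm j (z k) (hz k) fun i hi => hzs i k (hi.trans hjk)
  have hsep : ∀ j k, j ≠ k → δ * τC (z k) ≤ ‖z j - z k‖ := by
    intro j k hjk
    rcases lt_or_gt_of_ne hjk with h | h
    · have h1 := hzs j k h
      rw [Metric.mem_ball, dist_eq_norm, not_lt, norm_sub_rev] at h1
      exact (mul_le_mul_of_nonneg_left (hmono j k h) hδ.le).trans h1
    · have h1 := hzs k j h
      rwa [Metric.mem_ball, dist_eq_norm, not_lt] at h1
  -- scaling of norms
  have hscale : ∀ (r : ℝ) (x : ℂ), 0 < r → ‖x / (r : ℂ)‖ = ‖x‖ / r := by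
    intro r x hr
    rw [norm_div, Complex.norm_real, Real.norm_of_nonneg hr.le]
  refine ⟨z, hz, ?_, ?_, ?_, ?_⟩
  · intro j k hjk
    rw [Metric.mem_ball, dist_eq_norm, not_lt]
    exact hsep j k hjk
  · intro w hw
    by_contra! hcon
    have hτ : ∀ k, τC w ≤ τC (z k) := fun k => hzm k w hw fun j _ => hcon j
    have hr : 0 < δ * τC w := mul_pos hδ (hL.pos w hw)
    obtain ⟨M, hM⟩ := exists_nat_ge (1 / (δ * τC w))
    have := stmt9_pigeon M Set.univ (fun j => z j / ((δ * τC w : ℝ) : ℂ)) (by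
      intro j _
      rw [hscale _ _ hr]
      exact (div_le_div_of_nonneg_right ((hD _).1 (hz j)).le hr.le).trans hM) (by
      intro j _ k _ hjk
      rw [← sub_div, hscale _ _ hr, le_div_iff₀ hr]
      have h1 := hsep j k hjk
      have h2 := mul_le_mul_of_nonneg_left (hτ k) hδ.le
      linarith)
    exact Set.infinite_univ this.1
  · intro j w hw
    rw [Metric.mem_ball, dist_eq_norm] at hw
    have hwD : w ∈ unitDisc := by
      rw [hD]
      have h1 := norm_le_norm_add_norm_sub' w (z j)
      have h3 := mul_le_mul_of_nonneg_left (hL.upper _ (hz j)) hδ.le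
      have h0 := (hD _).1 (hz j)
      have h4 : δ * c₁ * (1 - ‖z j‖) ≤ 1 / 4 * (1 - ‖z j‖) :=
        mul_le_mul_of_nonneg_right hδ1 (by linarith)
      linarith
    have hlip := (abs_le.1 (hL.lip w hwD (z j) (hz j))).2
    have h5 : c₂ * ‖w - z j‖ ≤ c₂ * (δ * τC (z j)) := mul_le_mul_of_nonneg_left hw.le hc2.le
    have h6 : δ * c₂ * τC (z j) ≤ 1 / 4 * τC (z j) :=
      mul_le_mul_of_nonneg_right hδ2 (hpos j).le
    have h7 : τC w ≤ 5 / 4 * τC (z j) := by linarith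
    have h8 := mul_le_mul_of_nonneg_left h7 hδ.le
    have h9 := mul_pos hδ (hpos j)
    refine Metric.ball_subset_ball' ?_
    rw [dist_eq_norm]
    linarith
  · intro w hw
    have hτw := hL.pos w hw
    have hr : 0 < δ * τC w := mul_pos hδ hτw
    have hcomp : ∀ j, w ∈ Metric.ball (z j) (3 * (δ * τC (z j))) →
        ‖z j - w‖ < 3 * (δ * τC (z j)) ∧ τC (z j) ≤ 4 * τC w ∧ τC w ≤ 7 / 4 * τC (z j) := by
      intro j hj
      rw [Metric.mem_ball, dist_eq_norm] at hj
      have hlip := abs_le.1 (hL.lip w hw (z j) (hz j))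
      have h5 : c₂ * ‖w - z j‖ ≤ c₂ * (3 * (δ * τC (z j))) :=
        mul_le_mul_of_nonneg_left hj.le hc2.le
      have h6 : δ * c₂ * τC (z j) ≤ 1 / 4 * τC (z j) :=
        mul_le_mul_of_nonneg_right hδ2 (hpos j).le
      refine ⟨by rwa [norm_sub_rev], ?_, ?_⟩
      · linarith [hlip.1]
      · linarith [hlip.2]
    refine (stmt9_pigeon 12 _ (fun j => (z j - w) / ((δ * τC w : ℝ) : ℂ)) ?_ ?_).2
    · intro j hj
      obtain ⟨h1, h2, h3⟩ := hcomp j hj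
      rw [hscale _ _ hr, div_le_iff₀ hr]
      have h4 := mul_le_mul_of_nonneg_left h2 hδ.le
      push_cast
      linarith
    · intro j hj k hk hjk
      obtain ⟨h1, h2, h3⟩ := hcomp k hk
      rw [← sub_div, sub_sub_sub_cancel_right, hscale _ _ hr, le_div_iff₀ hr]
      have h4 := mul_le_mul_of_nonneg_left h3 hδ.le
      have h5 := hsep j k hjk
      have h6 := mul_pos hδ (hpos k)
      linarith

end
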